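/- Let F0∈ℝ and let ψ,u,v∥,ρ be smooth on {R>0}×ℝ_φ×ℝ_Z. Set B := ((1/R)∂_Zψ)e_R+(F0/R)e_φ+(−(1/R)∂_Rψ)e_Z, v_pol := (−R∂_Zu)e_R+(R∂_Ru)e_Z, ρ̂ := R²ρ, w := Δ_pol u, j := Δ*ψ. Then e_φ·∇×( ρ̂ (v_pol·∇(v∥B)) + ρ̂ ((v∥B)·∇v_pol) ) = −[ρ̂, v∥(∇_polψ·∇_pol u)] + [ρ̂ v∥ w, ψ] − [u, ρ̂ v∥ j] − [u, ρ̂ (∇_polψ·∇_pol v∥)] + R ∇·( ρ̂ (F0/R²) v∥ ∇_pol(∂_φ u) ), where ∇_pol a·∇_pol b := ∂_Ra∂_Rb+∂_Za∂_Zb and ∇_pol(∂_φu) is the vector field (∂_R∂_φu)e_R+(∂_Z∂_φu)e_Z with zero φ-component. -/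

import Mathlib

noncomputable section
set_option linter.unusedVariables false

open Real

/-- Scalar fields on the cylindrical domain, as functions of `(R, φ, Z)`. -/
abbrev F3 := ℝ → ℝ → ℝ → ℝ

/-- Partial derivative in `R`. -/
def dR (f : F3) (R φ Z : ℝ) : ℝ := deriv (fun r => f r φ Z) R

/-- Partial derivative in `φ`. -/
def dP (f : F3) (R φ Z : ℝ) : ℝ := deriv (fun a => f R a Z) φ

/-- Partial derivative in `Z`. -/
def dZ (f : F3) (R φ Z : ℝ) : ℝ := deriv (fun z => f R φ z) Z

/-- Joint smoothness (C^∞) of a scalar field. -/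
def Smooth3 (f : F3) : Prop :=
  ContDiff ℝ (⊤ : ℕ∞) fun q : ℝ × ℝ × ℝ => f q.1 q.2.1 q.2.2

/-- Poisson bracket `[a,b] = ∂_R a ∂_Z b − ∂_Z a ∂_R b`. -/
def pb (a b : F3) (R φ Z : ℝ) : ℝ :=
  dR a R φ Z * dZ b R φ Z - dZ a R φ Z * dR b R φ Z

/-- Grad–Shafranov operator `Δ* f = R ∂_R((1/R) ∂_R f) + ∂_ZZ f`. -/
def GS (f : F3) (R φ Z : ℝ) : ℝ :=
  R * dR (fun r a z => (1 / r) * dR f r a z) R φ Z + dZ (dZ f) R φ Z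

/-- Poloidal Laplacian `Δ_pol f = (1/R) ∂_R(R ∂_R f) + ∂_ZZ f`. -/
def LapPol (f : F3) (R φ Z : ℝ) : ℝ :=
  (1 / R) * dR (fun r a z => r * dR f r a z) R φ Z + dZ (dZ f) R φ Z

/-- Cylindrical divergence `∇·F = (1/R)∂_R(R F_R) + (1/R)∂_φ F_φ + ∂_Z F_Z`. -/
def divC (FR Fφ FZ : F3) (R φ Z : ℝ) : ℝ :=
  (1 / R) * dR (fun r a z => r * FR r a z) R φ Z + (1 / R) * dP Fφ R φ Z + dZ FZ R φ Z

/-- Scalar advection `X·∇f = X_R ∂_R f + (X_φ/R) ∂_φ f + X_Z ∂_Z f`. -/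
def advS (XvR XvP XvZ f : F3) (R φ Z : ℝ) : ℝ :=
  XvR R φ Z * dR f R φ Z + XvP R φ Z / R * dP f R φ Z + XvZ R φ Z * dZ f R φ Z

/-- `e_R`-component of the vector advection `X·∇Y`. -/
def advVR (XvR XvP XvZ YvR YvP YvZ : F3) (R φ Z : ℝ) : ℝ :=
  advS XvR XvP XvZ YvR R φ Z - XvP R φ Z * YvP R φ Z / R

/-- `e_φ`-component of the vector advection `X·∇Y`. -/
def advVP (XvR XvP XvZ YvR YvP YvZ : F3) (R φ Z : ℝ) : ℝ :=
  advS XvR XvP XvZ YvP R φ Z + XvP R φ Z * YvR R φ Z / R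

/-- `e_Z`-component of the vector advection `X·∇Y`. -/
def advVZ (XvR XvP XvZ YvR YvP YvZ : F3) (R φ Z : ℝ) : ℝ :=
  advS XvR XvP XvZ YvZ R φ Z

/-- `e_R`-component of `B = (1/R)∇ψ×e_φ + (F0/R)e_φ`. -/
def BR (ψ : F3) : F3 := fun R φ Z => (1 / R) * dZ ψ R φ Z

/-- `e_φ`-component of the magnetic field. -/
def BP (F0 : ℝ) : F3 := fun R _ _ => F0 / R

/-- `e_Z`-component of the magnetic field. -/
def BZ (ψ : F3) : F3 := fun R φ Z => -(1 / R) * dR ψ R φ Z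

/-- `e_R`-component of `v_pol = −R∇u×e_φ`. -/
def vR (u : F3) : F3 := fun R φ Z => -R * dZ u R φ Z

/-- `e_Z`-component of `v_pol = −R∇u×e_φ`. -/
def vZ (u : F3) : F3 := fun R φ Z => R * dR u R φ Z

/-- The zero field. -/
def zeroF : F3 := fun _ _ _ => 0

/-- `|B|² = (F0² + (∂_Rψ)² + (∂_Zψ)²)/R²`. -/
def B2 (F0 : ℝ) (ψ : F3) : F3 := fun R φ Z =>
  (F0 ^ 2 + (dR ψ R φ Z) ^ 2 + (dZ ψ R φ Z) ^ 2) / R ^ 2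

/-- `|B_pol|² = ((∂_Rψ)² + (∂_Zψ)²)/R²`. -/
def Bpol2 (ψ : F3) : F3 := fun R φ Z => ((dR ψ R φ Z) ^ 2 + (dZ ψ R φ Z) ^ 2) / R ^ 2

/-- `ρ̂ = R²ρ`. -/
def rh (ρ : F3) : F3 := fun R φ Z => R ^ 2 * ρ R φ Z

/-- `∇_pol a · ∇_pol b`. -/
def gdot (a b : F3) : F3 := fun R φ Z =>
  dR a R φ Z * dR b R φ Z + dZ a R φ Z * dZ b R φ Z

/-- `e_R`-component of `v∥ B`. -/
def XR (ψ vpar : F3) : F3 := fun R φ Z => vpar R φ Z * BR ψ R φ Z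

/-- `e_φ`-component of `v∥ B`. -/
def XP (F0 : ℝ) (vpar : F3) : F3 := fun R φ Z => vpar R φ Z * BP F0 R φ Z

/-- `e_Z`-component of `v∥ B`. -/
def XZ (ψ vpar : F3) : F3 := fun R φ Z => vpar R φ Z * BZ ψ R φ Z

/-- Joint differentiability of a scalar field at a point. -/
def DiffAt3 (f : F3) (R φ Z : ℝ) : Prop :=
  DifferentiableAt ℝ (fun q : ℝ × ℝ × ℝ => f q.1 q.2.1 q.2.2) (R, φ, Z)

namespace Smooth3

variable {f : F3}

lemma diffAt3 (hf : Smooth3 f) (R φ Z : ℝ) : DiffAt3 f R φ Z :=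
  (ContDiff.differentiable hf (by simp)) _

/-- A partial derivative of a smooth function along a fixed direction is smooth. -/
lemma contDiff_fderiv_apply {E : Type*} [NormedAddCommGroup E] [NormedSpace ℝ E] {g : E → ℝ}
    (hg : ContDiff ℝ (⊤ : ℕ∞) g) (v : E) :
    ContDiff ℝ (⊤ : ℕ∞) fun q => fderiv ℝ g q v :=
  (hg.fderiv_right (m := (⊤ : ℕ∞)) (by simp)).clm_apply contDiff_const

end Smooth3

lemma DiffAt3.hasDerivAt_dR {f : F3} {R φ Z : ℝ} (hf : DiffAt3 f R φ Z) :
    HasDerivAt (fun r => f r φ Z)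
      (fderiv ℝ (fun q : ℝ × ℝ × ℝ => f q.1 q.2.1 q.2.2) (R, φ, Z) (1, 0, 0)) R :=
  HasFDerivAt.comp_hasDerivAt (f := fun r : ℝ => ((r, φ, Z) : ℝ × ℝ × ℝ)) R
    (DifferentiableAt.hasFDerivAt hf)
    ((hasDerivAt_id R).prodMk ((hasDerivAt_const R φ).prodMk (hasDerivAt_const R Z)))

lemma DiffAt3.hasDerivAt_dP {f : F3} {R φ Z : ℝ} (hf : DiffAt3 f R φ Z) :
    HasDerivAt (fun a => f R a Z)
      (fderiv ℝ (fun q : ℝ × ℝ × ℝ => f q.1 q.2.1 q.2.2) (R, φ, Z) (0, 1, 0)) φ :=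
  HasFDerivAt.comp_hasDerivAt (f := fun a : ℝ => ((R, a, Z) : ℝ × ℝ × ℝ)) φ
    (DifferentiableAt.hasFDerivAt hf)
    ((hasDerivAt_const φ R).prodMk ((hasDerivAt_id φ).prodMk (hasDerivAt_const φ Z)))

lemma DiffAt3.hasDerivAt_dZ {f : F3} {R φ Z : ℝ} (hf : DiffAt3 f R φ Z) :
    HasDerivAt (fun z => f R φ z)
      (fderiv ℝ (fun q : ℝ × ℝ × ℝ => f q.1 q.2.1 q.2.2) (R, φ, Z) (0, 0, 1)) Z :=
  HasFDerivAt.comp_hasDerivAt (f := fun z : ℝ => ((R, φ, z) : ℝ × ℝ × ℝ)) Z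
    (DifferentiableAt.hasFDerivAt hf)
    ((hasDerivAt_const Z R).prodMk ((hasDerivAt_const Z φ).prodMk (hasDerivAt_id Z)))

namespace Smooth3

variable {f : F3}

lemma dR_eq (hf : Smooth3 f) (R φ Z : ℝ) : dR f R φ Z =
    fderiv ℝ (fun q : ℝ × ℝ × ℝ => f q.1 q.2.1 q.2.2) (R, φ, Z) (1, 0, 0) :=
  (hf.diffAt3 R φ Z).hasDerivAt_dR.deriv

lemma dP_eq (hf : Smooth3 f) (R φ Z : ℝ) : dP f R φ Z =
    fderiv ℝ (fun q : ℝ × ℝ × ℝ => f q.1 q.2.1 q.2.2) (R, φ, Z) (0, 1, 0) :=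
  (hf.diffAt3 R φ Z).hasDerivAt_dP.deriv

lemma dZ_eq (hf : Smooth3 f) (R φ Z : ℝ) : dZ f R φ Z =
    fderiv ℝ (fun q : ℝ × ℝ × ℝ => f q.1 q.2.1 q.2.2) (R, φ, Z) (0, 0, 1) :=
  (hf.diffAt3 R φ Z).hasDerivAt_dZ.deriv

lemma dR (hf : Smooth3 f) : Smooth3 (dR f) :=
by
  simpa only [Smooth3, hf.dR_eq] using contDiff_fderiv_apply hf (1, 0, 0)

lemma dP (hf : Smooth3 f) : Smooth3 (dP f) :=
by
  simpa only [Smooth3, hf.dP_eq] using contDiff_fderiv_apply hf (0, 1, 0)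

lemma dZ (hf : Smooth3 f) : Smooth3 (dZ f) :=
by
  simpa only [Smooth3, hf.dZ_eq] using contDiff_fderiv_apply hf (0, 0, 1)

/-- Directional derivatives along fixed directions of a smooth function commute. -/
lemma fderiv_fderiv_apply_comm {E : Type*} [NormedAddCommGroup E] [NormedSpace ℝ E] {g : E → ℝ}
    (hg : ContDiff ℝ (⊤ : ℕ∞) g) (x v w : E) :
    fderiv ℝ (fun q => fderiv ℝ g q v) x w = fderiv ℝ (fun q => fderiv ℝ g q w) x v := by
  have hd : DifferentiableAt ℝ (fderiv ℝ g) x :=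
    ((hg.fderiv_right (m := (⊤ : ℕ∞)) (by simp)).differentiable (by simp)) x
  have hs : IsSymmSndFDerivAt ℝ g x :=
    hg.contDiffAt.isSymmSndFDerivAt (by
      simpa using WithTop.coe_le_coe.2 (le_top : (2 : ℕ∞) ≤ ⊤))
  have key (a b : E) : fderiv ℝ (fun q => fderiv ℝ g q a) x b = fderiv ℝ (fderiv ℝ g) x b a := by
    rw [fderiv_clm_apply hd (differentiableAt_const a)]
    simp
  rw [key, key, hs.eq]

lemma dZ_dR (hf : Smooth3 f) : _root_.dZ (_root_.dR f) = _root_.dR (_root_.dZ f) := by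
  funext R φ Z
  rw [hf.dR.dZ_eq, hf.dZ.dR_eq]
  simp only [hf.dR_eq, hf.dZ_eq]
  exact fderiv_fderiv_apply_comm hf _ _ _

lemma dP_dR (hf : Smooth3 f) : _root_.dP (_root_.dR f) = _root_.dR (_root_.dP f) := by
  funext R φ Z
  rw [hf.dR.dP_eq, hf.dP.dR_eq]
  simp only [hf.dR_eq, hf.dP_eq]
  exact fderiv_fderiv_apply_comm hf _ _ _

lemma dP_dZ (hf : Smooth3 f) : _root_.dP (_root_.dZ f) = _root_.dZ (_root_.dP f) := by
  funext R φ Z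
  rw [hf.dZ.dP_eq, hf.dP.dZ_eq]
  simp only [hf.dZ_eq, hf.dP_eq]
  exact fderiv_fderiv_apply_comm hf _ _ _

end Smooth3

section Calculus

variable {f g : F3} {R φ Z : ℝ}

lemma DiffAt3.add (hf : DiffAt3 f R φ Z) (hg : DiffAt3 g R φ Z) :
    DiffAt3 (fun r a z => f r a z + g r a z) R φ Z :=
  DifferentiableAt.add hf hg

lemma DiffAt3.sub (hf : DiffAt3 f R φ Z) (hg : DiffAt3 g R φ Z) :
    DiffAt3 (fun r a z => f r a z - g r a z) R φ Z :=
  DifferentiableAt.sub hf hg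

lemma DiffAt3.neg (hf : DiffAt3 f R φ Z) : DiffAt3 (fun r a z => -f r a z) R φ Z :=
  DifferentiableAt.neg hf

lemma DiffAt3.mul (hf : DiffAt3 f R φ Z) (hg : DiffAt3 g R φ Z) :
    DiffAt3 (fun r a z => f r a z * g r a z) R φ Z :=
  DifferentiableAt.mul hf hg

lemma diffAt3_fst {k : ℝ → ℝ} (hk : DifferentiableAt ℝ k R) :
    DiffAt3 (fun r _ _ => k r) R φ Z :=
  DifferentiableAt.comp (R, φ, Z) (g := k) hk differentiableAt_fst

lemma dR_add (hf : DiffAt3 f R φ Z) (hg : DiffAt3 g R φ Z) :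
    dR (fun r a z => f r a z + g r a z) R φ Z = dR f R φ Z + dR g R φ Z :=
  deriv_fun_add hf.hasDerivAt_dR.differentiableAt hg.hasDerivAt_dR.differentiableAt

lemma dR_sub (hf : DiffAt3 f R φ Z) (hg : DiffAt3 g R φ Z) :
    dR (fun r a z => f r a z - g r a z) R φ Z = dR f R φ Z - dR g R φ Z :=
  deriv_fun_sub hf.hasDerivAt_dR.differentiableAt hg.hasDerivAt_dR.differentiableAt

lemma dR_neg : dR (fun r a z => -f r a z) R φ Z = -dR f R φ Z :=
  deriv.fun_neg

lemma dR_mul (hf : DiffAt3 f R φ Z) (hg : DiffAt3 g R φ Z) :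
    dR (fun r a z => f r a z * g r a z) R φ Z
      = dR f R φ Z * g R φ Z + f R φ Z * dR g R φ Z :=
  deriv_fun_mul hf.hasDerivAt_dR.differentiableAt hg.hasDerivAt_dR.differentiableAt

lemma dR_fst (k : ℝ → ℝ) : dR (fun r _ _ => k r) R φ Z = deriv k R := rfl

lemma dZ_add (hf : DiffAt3 f R φ Z) (hg : DiffAt3 g R φ Z) :
    dZ (fun r a z => f r a z + g r a z) R φ Z = dZ f R φ Z + dZ g R φ Z :=
  deriv_fun_add hf.hasDerivAt_dZ.differentiableAt hg.hasDerivAt_dZ.differentiableAt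

lemma dZ_sub (hf : DiffAt3 f R φ Z) (hg : DiffAt3 g R φ Z) :
    dZ (fun r a z => f r a z - g r a z) R φ Z = dZ f R φ Z - dZ g R φ Z :=
  deriv_fun_sub hf.hasDerivAt_dZ.differentiableAt hg.hasDerivAt_dZ.differentiableAt

lemma dZ_neg : dZ (fun r a z => -f r a z) R φ Z = -dZ f R φ Z :=
  deriv.fun_neg

lemma dZ_mul (hf : DiffAt3 f R φ Z) (hg : DiffAt3 g R φ Z) :
    dZ (fun r a z => f r a z * g r a z) R φ Z
      = dZ f R φ Z * g R φ Z + f R φ Z * dZ g R φ Z :=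
  deriv_fun_mul hf.hasDerivAt_dZ.differentiableAt hg.hasDerivAt_dZ.differentiableAt

lemma dZ_fst (k : ℝ → ℝ) : dZ (fun r _ _ => k r) R φ Z = 0 :=
  deriv_const _ _

lemma dP_neg : dP (fun r a z => -f r a z) R φ Z = -dP f R φ Z :=
  deriv.fun_neg

lemma dP_mul (hf : DiffAt3 f R φ Z) (hg : DiffAt3 g R φ Z) :
    dP (fun r a z => f r a z * g r a z) R φ Z
      = dP f R φ Z * g R φ Z + f R φ Z * dP g R φ Z :=
  deriv_fun_mul hf.hasDerivAt_dP.differentiableAt hg.hasDerivAt_dP.differentiableAt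

lemma dP_fst (k : ℝ → ℝ) : dP (fun r _ _ => k r) R φ Z = 0 :=
  deriv_const _ _

lemma dP_zeroF : dP zeroF R φ Z = 0 :=
  deriv_const _ _

lemma dR_congr_of_pos (h : ∀ r a z, 0 < r → f r a z = g r a z) (hR : 0 < R) :
    dR f R φ Z = dR g R φ Z :=
  Filter.EventuallyEq.deriv_eq <| by
    filter_upwards [lt_mem_nhds hR] with r hr using h r φ Z hr

lemma dZ_congr_of_pos (h : ∀ r a z, 0 < r → f r a z = g r a z) (hR : 0 < R) :
    dZ f R φ Z = dZ g R φ Z := by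
  unfold dZ
  congr 1
  funext z
  exact h R φ z hR

end Calculus

section Operators

variable {ψ u vpar f : F3} {R φ Z : ℝ}

lemma GS_eq (hf : Smooth3 f) (hR : R ≠ 0) :
    GS f R φ Z = dR (dR f) R φ Z - R⁻¹ * dR f R φ Z + dZ (dZ f) R φ Z := by
  have h1 : DiffAt3 (fun r _ _ => 1 / r) R φ Z :=
    diffAt3_fst (k := fun r => 1 / r) (by fun_prop (disch := exact hR))
  rw [GS, dR_mul h1 (hf.dR.diffAt3 _ _ _), dR_fst (fun r => 1 / r)]
  simp only [one_div, deriv_inv]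
  field_simp
  ring

lemma LapPol_eq (hf : Smooth3 f) (hR : R ≠ 0) :
    LapPol f R φ Z = dR (dR f) R φ Z + R⁻¹ * dR f R φ Z + dZ (dZ f) R φ Z := by
  have h1 : DiffAt3 (fun r _ _ => r) R φ Z := diffAt3_fst (k := fun r => r) (by fun_prop)
  rw [LapPol, dR_mul h1 (hf.dR.diffAt3 _ _ _), dR_fst (fun r => r)]
  simp only [deriv_id'']
  field_simp
  ring

lemma mixed_advection_Z_eq (F0 : ℝ) (ρ : F3) (hψ : Smooth3 ψ) (hu : Smooth3 u)
    (hv : Smooth3 vpar) (hR : R ≠ 0) :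
    rh ρ R φ Z
        * (advVZ (vR u) zeroF (vZ u) (XR ψ vpar) (XP F0 vpar) (XZ ψ vpar) R φ Z
          + advVZ (XR ψ vpar) (XP F0 vpar) (XZ ψ vpar) (vR u) zeroF (vZ u) R φ Z)
      = R ^ 2 * ρ R φ Z * ((dZ u R φ Z * (dR vpar R φ Z * dR ψ R φ Z + vpar R φ Z * dR (dR ψ) R φ Z
              - vpar R φ Z * dR ψ R φ Z * R⁻¹)
            - dR u R φ Z * (dZ vpar R φ Z * dR ψ R φ Z + vpar R φ Z * dR (dZ ψ) R φ Z))
          + (vpar R φ Z * dZ ψ R φ Z * (dR u R φ Z * R⁻¹ + dR (dR u) R φ Z)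
            + vpar R φ Z * F0 * R⁻¹ * dR (dP u) R φ Z
            - vpar R φ Z * dR ψ R φ Z * dR (dZ u) R φ Z)) := by
  delta vR vZ XR XP XZ BR BP BZ
  simp (maxDischargeDepth := 30) only [advVZ, advS, rh, zeroF, div_eq_mul_inv, sq, mul_inv,
    dR_neg, dR_mul, dR_fst, dZ_neg, dZ_mul, dZ_fst, dP_neg, dP_mul, dP_fst,
    DiffAt3.neg, DiffAt3.mul, diffAt3_fst, Smooth3.diffAt3,
    Smooth3.dR, Smooth3.dZ_dR, Smooth3.dP_dR,
    deriv_id'', deriv_const, deriv_inv, differentiableAt_fun_id, differentiableAt_const,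
    differentiableAt_inv, ne_eq, not_false_eq_true, hψ, hu, hv, hR]
  field_simp
  ring

lemma mixed_advection_R_eq (F0 : ℝ) (ρ : F3) (hψ : Smooth3 ψ) (hu : Smooth3 u)
    (hv : Smooth3 vpar) (hR : R ≠ 0) :
    rh ρ R φ Z
        * (advVR (vR u) zeroF (vZ u) (XR ψ vpar) (XP F0 vpar) (XZ ψ vpar) R φ Z
          + advVR (XR ψ vpar) (XP F0 vpar) (XZ ψ vpar) (vR u) zeroF (vZ u) R φ Z)
      = R ^ 2 * ρ R φ Z * ((dR u R φ Z * (dZ vpar R φ Z * dZ ψ R φ Z + vpar R φ Z * dZ (dZ ψ) R φ Z)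
            - dZ u R φ Z * (dR vpar R φ Z * dZ ψ R φ Z + vpar R φ Z * dR (dZ ψ) R φ Z
              - vpar R φ Z * dZ ψ R φ Z * R⁻¹))
          + (vpar R φ Z * dR ψ R φ Z * dZ (dZ u) R φ Z
            - vpar R φ Z * F0 * R⁻¹ * dZ (dP u) R φ Z
            - vpar R φ Z * dZ ψ R φ Z * (dZ u R φ Z * R⁻¹ + dR (dZ u) R φ Z))) := by
  delta vR vZ XR XP XZ BR BP BZ
  simp (maxDischargeDepth := 30) only [advVR, advS, rh, zeroF, div_eq_mul_inv, sq, mul_inv,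
    dR_neg, dR_mul, dR_fst, dZ_neg, dZ_mul, dZ_fst, dP_neg, dP_mul, dP_fst,
    DiffAt3.neg, DiffAt3.mul, diffAt3_fst, Smooth3.diffAt3,
    Smooth3.dZ, Smooth3.dP_dZ,
    deriv_id'', deriv_const, deriv_inv, differentiableAt_fun_id, differentiableAt_const,
    differentiableAt_inv, ne_eq, not_false_eq_true, hψ, hu, hv, hR]
  field_simp
  ring

end Operators

/-- `e_φ`-component of the curl of the mixed advection terms
`ρ̂ (v_pol·∇(v∥B)) + ρ̂ ((v∥B)·∇v_pol)`. -/
theorem curl_phi_of_mixed_advection (F0 : ℝ) (ψ u vpar ρ : F3)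
    (hψ : Smooth3 ψ) (hu : Smooth3 u) (hv : Smooth3 vpar) (hρ : Smooth3 ρ) :
    ∀ R φ Z : ℝ, 0 < R →
      dR (fun r a z => rh ρ r a z
            * (advVZ (vR u) zeroF (vZ u) (XR ψ vpar) (XP F0 vpar) (XZ ψ vpar) r a z
              + advVZ (XR ψ vpar) (XP F0 vpar) (XZ ψ vpar) (vR u) zeroF (vZ u) r a z)) R φ Z
        - dZ (fun r a z => rh ρ r a z
            * (advVR (vR u) zeroF (vZ u) (XR ψ vpar) (XP F0 vpar) (XZ ψ vpar) r a z
              + advVR (XR ψ vpar) (XP F0 vpar) (XZ ψ vpar) (vR u) zeroF (vZ u) r a z)) R φ Z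
      = -pb (rh ρ) (fun r a z => vpar r a z * gdot ψ u r a z) R φ Z
        + pb (fun r a z => rh ρ r a z * vpar r a z * LapPol u r a z) ψ R φ Z
        - pb u (fun r a z => rh ρ r a z * vpar r a z * GS ψ r a z) R φ Z
        - pb u (fun r a z => rh ρ r a z * gdot ψ vpar r a z) R φ Z
        + R * divC
            (fun r a z => rh ρ r a z * (F0 / r ^ 2) * vpar r a z * dR (dP u) r a z)
            zeroF
            (fun r a z => rh ρ r a z * (F0 / r ^ 2) * vpar r a z * dZ (dP u) r a z)
            R φ Z := by
  intro R φ Z hR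
  have hR' : R ≠ 0 := hR.ne'
  rw [dR_congr_of_pos (fun r a z hr => mixed_advection_Z_eq F0 ρ hψ hu hv hr.ne') hR,
    dZ_congr_of_pos (fun r a z hr => mixed_advection_R_eq F0 ρ hψ hu hv hr.ne') hR]
  have hLR : dR (fun r a z => rh ρ r a z * vpar r a z * LapPol u r a z) R φ Z
      = dR (fun r a z => rh ρ r a z * vpar r a z
          * (dR (dR u) r a z + r⁻¹ * dR u r a z + dZ (dZ u) r a z)) R φ Z :=
    dR_congr_of_pos (fun r a z hr => by rw [LapPol_eq hu hr.ne']) hR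
  have hLZ : dZ (fun r a z => rh ρ r a z * vpar r a z * LapPol u r a z) R φ Z
      = dZ (fun r a z => rh ρ r a z * vpar r a z
          * (dR (dR u) r a z + r⁻¹ * dR u r a z + dZ (dZ u) r a z)) R φ Z :=
    dZ_congr_of_pos (fun r a z hr => by rw [LapPol_eq hu hr.ne']) hR
  have hGR : dR (fun r a z => rh ρ r a z * vpar r a z * GS ψ r a z) R φ Z
      = dR (fun r a z => rh ρ r a z * vpar r a z
          * (dR (dR ψ) r a z - r⁻¹ * dR ψ r a z + dZ (dZ ψ) r a z)) R φ Z :=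
    dR_congr_of_pos (fun r a z hr => by rw [GS_eq hψ hr.ne']) hR
  have hGZ : dZ (fun r a z => rh ρ r a z * vpar r a z * GS ψ r a z) R φ Z
      = dZ (fun r a z => rh ρ r a z * vpar r a z
          * (dR (dR ψ) r a z - r⁻¹ * dR ψ r a z + dZ (dZ ψ) r a z)) R φ Z :=
    dZ_congr_of_pos (fun r a z hr => by rw [GS_eq hψ hr.ne']) hR
  simp only [pb, hLR, hLZ, hGR, hGZ]
  delta rh gdot
  simp (maxDischargeDepth := 30) only [divC, dP_zeroF, div_eq_mul_inv, sq, mul_inv,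
    dR_add, dR_sub, dR_mul, dR_fst, dZ_add, dZ_sub, dZ_mul, dZ_fst,
    DiffAt3.add, DiffAt3.sub, DiffAt3.mul, diffAt3_fst, Smooth3.diffAt3,
    Smooth3.dR, Smooth3.dP, Smooth3.dZ, Smooth3.dZ_dR,
    deriv_id'', deriv_const, deriv_inv, differentiableAt_fun_id, differentiableAt_const,
    differentiableAt_inv, ne_eq, not_false_eq_true, hψ, hu, hv, hρ, hR']
  field_simp
  ring
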